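/- If R is a semihereditary commutative ring, then the natural inclusion R → R[t₁,t₁⁻¹,...,tₙ,tₙ⁻¹] into the Laurent polynomial ring induces an isomorphism on Picard groups. -/

import Mathlib

universe u

/-- A finitely generated projective module. -/
def IsFGProj (R : Type u) [CommRing R] (M : ModuleCat.{u} R) : Prop :=
  Module.Finite R M ∧ Module.Projective R M

/-- Isomorphism-class generators for `K₀`. -/
def FGProjCl (R : Type u) [CommRing R] := {M : ModuleCat.{u} R // IsFGProj R M}

/-- Relations `[M ⊕ N] = [M] + [N]` defining `K₀(R)`. -/
def K0Rels (R : Type u) [CommRing R] : AddSubgroup (FreeAbelianGroup (FGProjCl R)) :=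
  AddSubgroup.closure {x | ∃ M N P : FGProjCl R,
    Nonempty ((P.1 : Type u) ≃ₗ[R] ((M.1 : Type u) × (N.1 : Type u))) ∧
    x = FreeAbelianGroup.of P - FreeAbelianGroup.of M - FreeAbelianGroup.of N}

/-- The Grothendieck group `K₀(R)` of finitely generated projective `R`-modules. -/
abbrev K0 (R : Type u) [CommRing R] := FreeAbelianGroup (FGProjCl R) ⧸ K0Rels R

/-- The class of a finitely generated projective module in `K₀(R)`. -/
def K0.cls (R : Type u) [CommRing R] (M : FGProjCl R) : K0 R :=
  QuotientAddGroup.mk (FreeAbelianGroup.of M)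

/-- The local rank of a module at a prime. -/
noncomputable def rankAt (R : Type u) [CommRing R] (p : PrimeSpectrum R) (M : Type u)
    [AddCommGroup M] [Module R M] : ℕ :=
  Module.finrank (Localization.AtPrime p.asIdeal) (LocalizedModule p.asIdeal.primeCompl M)

/-- An invertible module: finitely generated projective of constant rank one. -/
def IsInvMod (R : Type u) [CommRing R] (M : ModuleCat.{u} R) : Prop :=
  IsFGProj R M ∧ ∀ p : PrimeSpectrum R, rankAt R p M = 1

/-- Isomorphism-class generators for the Picard group. -/
def InvCl (R : Type u) [CommRing R] := {M : ModuleCat.{u} R // IsInvMod R M}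

/-- Relations `[M ⊗ N] = [M] + [N]` defining `Pic(R)`. -/
def PicRels (R : Type u) [CommRing R] : AddSubgroup (FreeAbelianGroup (InvCl R)) :=
  AddSubgroup.closure {x | ∃ M N P : InvCl R,
    Nonempty ((P.1 : Type u) ≃ₗ[R] (TensorProduct R (M.1 : Type u) (N.1 : Type u))) ∧
    x = FreeAbelianGroup.of P - FreeAbelianGroup.of M - FreeAbelianGroup.of N}

/-- The Picard group of `R`. -/
abbrev PicG (R : Type u) [CommRing R] := FreeAbelianGroup (InvCl R) ⧸ PicRels R

/-- The class of an invertible module in `Pic(R)`. -/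
def PicG.cls (R : Type u) [CommRing R] (M : InvCl R) : PicG R :=
  QuotientAddGroup.mk (FreeAbelianGroup.of M)

/-- A commutative ring is semihereditary if every finitely generated ideal is projective. -/
def IsSemihereditary (R : Type u) [CommRing R] : Prop :=
  ∀ I : Ideal R, I.FG → Module.Projective R I

section Invertible

open TensorProduct

theorem contractLeft_surjective_of_rankAt_eq_one (R : Type u) [CommRing R] (M : Type u)
    [AddCommGroup M] [Module R M] [Module.Finite R M] [Module.Projective R M]
    (h : ∀ p : PrimeSpectrum R, rankAt R p M = 1) :
    Function.Surjective (contractLeft R M) := by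
  rw [← LinearMap.range_eq_top]
  by_contra hne
  obtain ⟨m, hm, hle⟩ := Ideal.exists_le_maximal _ hne
  have hmem : ∀ (f : Module.Dual R M) (x : M), f x ∈ m := fun f x =>
    hle ⟨f ⊗ₜ x, contractLeft_apply f x⟩
  have htop : (⊤ : Submodule R M) ≤ m • ⊤ := by
    obtain ⟨n, f, g, -, -, hfg⟩ := Module.Finite.exists_comp_eq_id_of_projective R M
    intro x _
    have hx : f (g x) = x := LinearMap.congr_fun hfg x
    rw [← hx, pi_eq_sum_univ' (g x), map_sum]
    refine Submodule.sum_mem _ fun i _ => ?_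
    rw [map_smul]
    exact Submodule.smul_mem_smul (hmem (LinearMap.proj i ∘ₗ g) x) trivial
  obtain ⟨r, hr, hr0⟩ := Submodule.exists_sub_one_mem_and_smul_eq_zero_of_fg_of_le_smul m ⊤
    Module.Finite.fg_top htop
  have hrm : r ∈ m.primeCompl := fun hrm =>
    hm.ne_top ((Ideal.eq_top_iff_one _).2 (by simpa using m.sub_mem hrm hr))
  have : Subsingleton (LocalizedModule m.primeCompl M) := by
    rw [LocalizedModule.subsingleton_iff]
    exact fun x => ⟨r, hrm, hr0 x trivial⟩
  have h1 := h ⟨m, hm.isPrime⟩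
  rw [rankAt, Module.finrank_zero_of_subsingleton] at h1
  exact zero_ne_one h1

theorem invertible_of_rankAt_eq_one (R : Type u) [CommRing R] (M : Type u)
    [AddCommGroup M] [Module R M] [Module.Finite R M] [Module.Projective R M]
    (h : ∀ p : PrimeSpectrum R, rankAt R p M = 1) : Module.Invertible R M := by
  have : Module.FinitePresentation R M := Module.finitePresentation_of_projective R M
  let φ : Module.Dual R M ⊗[R] M →ₗ[R] R := contractLeft R M
  have hφ : Function.Surjective φ := contractLeft_surjective_of_rankAt_eq_one R M h
  refine ⟨show Function.Bijective φ from
    Module.bijective_of_surjective_of_rankAtStalk_eq (R := R)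
      (M := Module.Dual R M ⊗[R] M) (N := R) (φ := φ) hφ fun m hm => ?_⟩
  have : Nontrivial R := by
    by_contra hR
    rw [not_nontrivial_iff_subsingleton] at hR
    exact hm.ne_top (Subsingleton.elim _ _)
  have hM : Module.rankAtStalk M (⟨m, hm.isPrime⟩ : PrimeSpectrum R) = 1 := h _
  have hD : Module.rankAtStalk (Module.Dual R M) (⟨m, hm.isPrime⟩ : PrimeSpectrum R) = 1 := by
    have : Module.Free (Localization m.primeCompl) (LocalizedModule m.primeCompl M) :=
      Module.free_of_flat_of_isLocalRing
    have e := (IsLocalizedModule.iso m.primeCompl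
      (LocalizedModule.map m.primeCompl (M := M) (N := R))).extendScalarsOfIsLocalization
        m.primeCompl (Localization m.primeCompl)
    have e' := (IsLocalizedModule.iso m.primeCompl
      (Algebra.linearMap R (Localization m.primeCompl))).extendScalarsOfIsLocalization
        m.primeCompl (Localization m.primeCompl)
    refine e.finrank_eq.trans ?_
    have : Module.Free (Localization m.primeCompl) (LocalizedModule m.primeCompl R) :=
      .of_equiv e'.symm
    rw [Module.finrank_linearMap, e'.finrank_eq, Module.finrank_self, mul_one]
    exact hM
  rw [Module.rankAtStalk_tensorProduct, Pi.mul_apply, hM, hD, Module.rankAtStalk_self]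
  rfl

theorem isInvMod_iff_invertible (R : Type u) [CommRing R] (M : ModuleCat.{u} R) :
    IsInvMod R M ↔ Module.Invertible R M := by
  refine ⟨fun ⟨⟨_, _⟩, h⟩ => invertible_of_rankAt_eq_one R M h, fun h =>
    ⟨⟨inferInstance, inferInstance⟩, fun p => ?_⟩⟩
  have : Module.Free (Localization.AtPrime p.asIdeal)
    (LocalizedModule p.asIdeal.primeCompl M) := Module.free_of_flat_of_isLocalRing
  exact Module.Invertible.finrank_eq_one _ _

end Invertible

section PicEquiv

open TensorProduct

instance (R : Type u) [CommRing R] (M : InvCl R) : Module.Invertible R M.1 :=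
  (isInvMod_iff_invertible R M.1).1 M.2

/-- An invertible module, viewed as a generator of `PicG`. -/
def InvCl.of (R : Type u) [CommRing R] (M : Type u) [AddCommGroup M] [Module R M]
    [Module.Invertible R M] : InvCl R :=
  ⟨ModuleCat.of R M, (isInvMod_iff_invertible R _).2 ‹_›⟩

/-- The comparison map from `PicG` to Mathlib's Picard group. -/
noncomputable def PicG.toPic (R : Type u) [CommRing R] :
    PicG R →+ Additive (CommRing.Pic R) :=
  QuotientAddGroup.lift (PicRels R)
    (FreeAbelianGroup.lift fun M : InvCl R => Additive.ofMul (CommRing.Pic.mk R M.1)) <| by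
      rw [PicRels, AddSubgroup.closure_le]
      rintro _ ⟨M, N, P, ⟨e⟩, rfl⟩
      simp only [SetLike.mem_coe, AddMonoidHom.mem_ker, map_sub, FreeAbelianGroup.lift_apply_of]
      rw [sub_sub, sub_eq_zero, ← ofMul_mul, ← CommRing.Pic.mk_tensor,
        CommRing.Pic.mk_eq_mk_iff.2 ⟨e⟩]

theorem PicG.toPic_cls (R : Type u) [CommRing R] (M : InvCl R) :
    PicG.toPic R (PicG.cls R M) = Additive.ofMul (CommRing.Pic.mk R M.1) := by
  simp [PicG.toPic, PicG.cls]

theorem PicG.cls_eq_add (R : Type u) [CommRing R] {M N P : InvCl R}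
    (e : P.1 ≃ₗ[R] M.1 ⊗[R] N.1) : PicG.cls R P = PicG.cls R M + PicG.cls R N := by
  rw [← sub_eq_zero, ← sub_sub]
  exact (QuotientAddGroup.eq_zero_iff _).2 (AddSubgroup.subset_closure ⟨M, N, P, ⟨e⟩, rfl⟩)

theorem PicG.cls_eq_zero (R : Type u) [CommRing R] {M : InvCl R} (e : M.1 ≃ₗ[R] R) :
    PicG.cls R M = 0 := by
  have := PicG.cls_eq_add R (M := M) (N := M) (P := M)
    ((TensorProduct.lid R M.1).symm ≪≫ₗ TensorProduct.congr e.symm (.refl R _))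
  simpa using this

theorem PicG.exists_cls_eq (R : Type u) [CommRing R] (x : PicG R) :
    ∃ M : InvCl R, PicG.cls R M = x := by
  obtain ⟨x, rfl⟩ := QuotientAddGroup.mk_surjective x
  induction x using FreeAbelianGroup.induction_on with
  | zero => exact ⟨InvCl.of R R, PicG.cls_eq_zero R (LinearEquiv.refl R R)⟩
  | of M => exact ⟨M, rfl⟩
  | neg M _ =>
    refine ⟨InvCl.of R (Module.Dual R M.1), ?_⟩
    have h := PicG.cls_eq_add R (M := InvCl.of R (Module.Dual R M.1)) (N := M)
      (P := InvCl.of R (Module.Dual R M.1 ⊗[R] M.1)) (LinearEquiv.refl R _)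
    rw [PicG.cls_eq_zero R (M := InvCl.of R (Module.Dual R M.1 ⊗[R] M.1))
      (Module.Invertible.linearEquiv R M.1)] at h
    exact eq_neg_of_add_eq_zero_left h.symm
  | add x y hx hy =>
    obtain ⟨M, hM⟩ := hx
    obtain ⟨N, hN⟩ := hy
    refine ⟨InvCl.of R (M.1 ⊗[R] N.1), ?_⟩
    rw [PicG.cls_eq_add R (M := M) (N := N) (LinearEquiv.refl R _), hM, hN]
    rfl

theorem PicG.toPic_bijective (R : Type u) [CommRing R] : Function.Bijective (PicG.toPic R) := by
  constructor
  · rw [injective_iff_map_eq_zero]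
    intro x hx
    obtain ⟨M, rfl⟩ := PicG.exists_cls_eq R x
    rw [PicG.toPic_cls, ofMul_eq_zero, CommRing.Pic.mk_eq_one_iff] at hx
    exact PicG.cls_eq_zero R hx.some
  · intro x
    refine ⟨PicG.cls R (InvCl.of R x.toMul), ?_⟩
    rw [PicG.toPic_cls]
    exact congrArg Additive.ofMul CommRing.Pic.mk_eq_self

end PicEquiv

section Gauss

theorem exists_dvd_mul_of_semihereditary {R : Type u} [CommRing R] (hR : IsSemihereditary R)
    (a b : R) : ∃ r : R, a ∣ r * b ∧ b ∣ (1 - r) * a := by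
  have := hR (Ideal.span {a, b}) (Submodule.fg_span (Set.toFinite _))
  let A : Ideal.span {a, b} := ⟨a, Ideal.subset_span (by simp)⟩
  let B : Ideal.span {a, b} := ⟨b, Ideal.subset_span (by simp)⟩
  let f : R × R →ₗ[R] Ideal.span {a, b} :=
    (LinearMap.toSpanSingleton R _ A).coprod (LinearMap.toSpanSingleton R _ B)
  have hf : Function.Surjective f := by
    rintro ⟨x, hx⟩
    obtain ⟨c, d, rfl⟩ := Ideal.mem_span_pair.1 hx
    exact ⟨(c, d), by ext; simp [f, A, B]⟩
  obtain ⟨g, hg⟩ := Module.projective_lifting_property f LinearMap.id hf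
  have hA : (g A).1 * a + (g A).2 * b = a := by
    simpa [f, A, B] using congrArg Subtype.val (LinearMap.congr_fun hg A)
  have hAB : a • B = b • A := by ext; simp [A, B, mul_comm]
  have h := congrArg Prod.fst (congrArg g hAB)
  simp only [map_smul, Prod.smul_fst, smul_eq_mul] at h
  exact ⟨(g A).1, ⟨(g B).1, by rw [h]; ring⟩, ⟨(g A).2, by linear_combination -hA⟩⟩

theorem exists_mul_eq_self_of_semihereditary {R : Type u} [CommRing R] (hR : IsSemihereditary R)
    (a : R) : ∃ e : R, e * a = a ∧ ∀ y, y * a = 0 → y * e = 0 := by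
  have := hR (Ideal.span {a}) ⟨{a}, by simp⟩
  let A : Ideal.span {a} := ⟨a, Ideal.subset_span (by simp)⟩
  have hf : Function.Surjective (LinearMap.toSpanSingleton R (Ideal.span {a}) A) := by
    rintro ⟨x, hx⟩
    obtain ⟨c, rfl⟩ := Ideal.mem_span_singleton'.1 hx
    exact ⟨c, by ext; simp [A]⟩
  obtain ⟨g, hg⟩ := Module.projective_lifting_property _ LinearMap.id hf
  refine ⟨g A, by simpa [A] using congrArg Subtype.val (LinearMap.congr_fun hg A), fun y hy => ?_⟩
  have hA : y • A = 0 := by ext; simpa [A] using hy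
  simpa using congrArg g hA

theorem isDomain_localization_of_semihereditary {R : Type u} [CommRing R]
    (hR : IsSemihereditary R) (m : Ideal R) [m.IsPrime] :
    IsDomain (Localization.AtPrime m) := by
  have : NoZeroDivisors (Localization.AtPrime m) := by
    refine ⟨fun {x y} hxy => ?_⟩
    obtain ⟨⟨a, s⟩, hx⟩ := IsLocalization.surj m.primeCompl x
    obtain ⟨⟨b, t⟩, hy⟩ := IsLocalization.surj m.primeCompl y
    have hs := IsLocalization.map_units (Localization.AtPrime m) s
    have ht := IsLocalization.map_units (Localization.AtPrime m) t
    rw [← hs.mul_left_eq_zero, ← ht.mul_left_eq_zero (a := y), hx, hy]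
    have hab : algebraMap R (Localization.AtPrime m) (b * a) = 0 := by
      rw [map_mul, ← hx, ← hy]; linear_combination (algebraMap R _ s.1 * algebraMap R _ t.1) * hxy
    rw [IsLocalization.map_eq_zero_iff m.primeCompl] at hab
    obtain ⟨r, hr⟩ := hab
    obtain ⟨e, hea, he⟩ := exists_mul_eq_self_of_semihereditary hR a
    have h1 := he (r * b) (by rw [mul_assoc, hr])
    simp only [IsLocalization.map_eq_zero_iff m.primeCompl]
    by_cases hem : e ∈ m
    · left
      refine ⟨⟨1 - e, fun h => ?_⟩, by simp [sub_mul, hea]⟩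
      exact (inferInstance : m.IsPrime).ne_top
        ((Ideal.eq_top_iff_one _).2 (by simpa using m.add_mem h hem))
    · exact Or.inr ⟨r * ⟨e, hem⟩, by simpa [mul_right_comm] using h1⟩
  exact NoZeroDivisors.to_isDomain _

theorem valuationRing_localization_of_semihereditary {R : Type u} [CommRing R]
    (hR : IsSemihereditary R) (m : Ideal R) [m.IsPrime] [IsDomain (Localization.AtPrime m)] :
    ValuationRing (Localization.AtPrime m) := by
  rw [ValuationRing.iff_dvd_total]
  refine ⟨fun x y => ?_⟩
  obtain ⟨⟨a, s⟩, hx⟩ := IsLocalization.surj m.primeCompl x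
  obtain ⟨⟨b, t⟩, hy⟩ := IsLocalization.surj m.primeCompl y
  have hs := IsLocalization.map_units (Localization.AtPrime m) s
  have ht := IsLocalization.map_units (Localization.AtPrime m) t
  obtain ⟨r, h1, h2⟩ := exists_dvd_mul_of_semihereditary hR a b
  rw [← hs.mul_right_dvd (a := x), ← hs.dvd_mul_right (b := x), ← ht.mul_right_dvd (a := y),
    ← ht.dvd_mul_right (b := y), hx, hy]
  replace h1 := map_dvd (algebraMap R (Localization.AtPrime m)) h1
  replace h2 := map_dvd (algebraMap R (Localization.AtPrime m)) h2
  rw [map_mul] at h1 h2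
  by_cases hr : r ∈ m
  · have hr' : IsUnit (algebraMap R (Localization.AtPrime m) (1 - r)) :=
      IsLocalization.map_units _ (⟨1 - r, fun h => (inferInstance : m.IsPrime).ne_top
        ((Ideal.eq_top_iff_one _).2 (by simpa using m.add_mem h hr))⟩ : m.primeCompl)
    exact Or.inr (hr'.dvd_mul_left.1 h2)
  · have hr' : IsUnit (algebraMap R (Localization.AtPrime m) r) :=
      IsLocalization.map_units _ (⟨r, hr⟩ : m.primeCompl)
    exact Or.inl (hr'.dvd_mul_left.1 h1)

theorem exists_eq_smul_isUnit_coeff {V G : Type*} [CommRing V] [IsDomain V] [ValuationRing V]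
    {f : AddMonoidAlgebra V G} (hf : f ≠ 0) :
    ∃ (c : V) (f₀ : AddMonoidAlgebra V G), f = c • f₀ ∧ ∃ g, IsUnit (f₀.coeff g) := by
  have key : ∀ s : Finset G, s.Nonempty → ∃ g ∈ s, ∀ h ∈ s, f.coeff g ∣ f.coeff h := by
    intro s hs
    induction hs using Finset.Nonempty.cons_induction with
    | singleton a => exact ⟨a, by simp⟩
    | cons a s ha hs ih =>
      obtain ⟨g, hg, h⟩ := ih
      rcases ValuationRing.dvd_total (f.coeff a) (f.coeff g) with h' | h'
      · exact ⟨a, by simp, by simpa using fun x hx => h'.trans (h x hx)⟩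
      · exact ⟨g, by simp [hg], by simpa using ⟨h', h⟩⟩
  have hsupp : f.coeff.support.Nonempty := by
    rw [Finsupp.support_nonempty_iff]
    exact fun h => hf (by ext g; simp [h])
  obtain ⟨g, hg, h⟩ := key _ hsupp
  rw [Finsupp.mem_support_iff] at hg
  have hmem : f ∈ Set.range (AddMonoidAlgebra.map (M := G) (AddMonoidHom.mulLeft (f.coeff g))) := by
    rw [AddMonoidAlgebra.range_map]
    intro x
    by_cases hx : f.coeff x = 0
    · exact ⟨0, by simp [hx]⟩
    · obtain ⟨c, hc⟩ := h x (by simpa using hx)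
      exact ⟨c, by simp [hc]⟩
  obtain ⟨f₀, hf₀⟩ := hmem
  have hcoeff : ∀ x, f.coeff x = f.coeff g * f₀.coeff x := fun x => by
    conv_lhs => rw [← hf₀]
    simp
  refine ⟨f.coeff g, f₀, by ext x; simpa using hcoeff x, g, ?_⟩
  rw [mul_left_cancel₀ hg ((hcoeff g).symm.trans (mul_one _).symm)]
  exact isUnit_one

theorem dvd_coeff_mul_coeff_of_valuationRing {V G : Type*} [CommRing V] [IsDomain V]
    [ValuationRing V] [AddCommMonoid G] [IsCancelAdd G] [UniqueSums G] (d : V)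
    (f h : AddMonoidAlgebra V G) (hd : ∀ g, d ∣ (f * h).coeff g) (a b : G) :
    d ∣ f.coeff a * h.coeff b := by
  by_cases hf : f = 0
  · simp [hf]
  by_cases hh : h = 0
  · simp [hh]
  obtain ⟨c, f, rfl, x, hx⟩ := exists_eq_smul_isUnit_coeff hf
  obtain ⟨c', h, rfl, y, hy⟩ := exists_eq_smul_isUnit_coeff hh
  let φ := AddMonoidAlgebra.mapRingHom G (IsLocalRing.residue V)
  have hne : ∀ (p : AddMonoidAlgebra V G) (g : G), IsUnit (p.coeff g) → φ p ≠ 0 := by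
    intro p g hg h0
    have := congrArg (fun q => q.coeff g) h0
    simp only [φ, AddMonoidAlgebra.coeff_mapRingHom] at this
    exact (IsLocalRing.residue_ne_zero_iff_isUnit _).2 hg (by simpa using this)
  have hmul : φ (f * h) ≠ 0 := by
    rw [map_mul]
    exact mul_ne_zero (hne f x hx) (hne h y hy)
  have ⟨g, hg⟩ : ∃ g, IsUnit ((f * h).coeff g) := by
    by_contra! hcon
    refine hmul ?_
    ext g
    rw [AddMonoidAlgebra.coeff_mapRingHom]
    by_contra h0
    exact hcon g ((IsLocalRing.residue_ne_zero_iff_isUnit _).1 (by simpa using h0))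
  have h1 := hd g
  rw [smul_mul_smul_comm, AddMonoidAlgebra.coeff_smul, Finsupp.smul_apply, smul_eq_mul,
    hg.dvd_mul_right] at h1
  refine h1.trans ⟨f.coeff a * h.coeff b, ?_⟩
  simp only [AddMonoidAlgebra.coeff_smul, Finsupp.smul_apply, smul_eq_mul]
  ring

theorem dvd_coeff_mul_coeff_of_semihereditary {R : Type u} [CommRing R] (hR : IsSemihereditary R)
    {G : Type*} [AddCommMonoid G] [IsCancelAdd G] [UniqueSums G] (d : R)
    (f h : AddMonoidAlgebra R G) (hd : ∀ g, d ∣ (f * h).coeff g) (a b : G) :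
    d ∣ f.coeff a * h.coeff b := by
  rw [← Ideal.mem_span_singleton]
  refine Ideal.mem_of_localization_maximal fun m hm => ?_
  have := isDomain_localization_of_semihereditary hR m
  have := valuationRing_localization_of_semihereditary hR m
  rw [Ideal.map_span, Set.image_singleton, Ideal.mem_span_singleton, map_mul]
  let φ := AddMonoidAlgebra.mapRingHom G (algebraMap R (Localization.AtPrime m))
  have := dvd_coeff_mul_coeff_of_valuationRing (algebraMap R (Localization.AtPrime m) d)
    (φ f) (φ h) (fun g => ?_) a b
  · simpa [φ] using this
  · rw [← map_mul, AddMonoidAlgebra.coeff_mapRingHom]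
    exact map_dvd (algebraMap R (Localization.AtPrime m)) (hd g)

end Gauss


section RegularTotalFractionRing

theorem exists_mul_mul_eq_self_fractionRing {R : Type*} [CommRing R]
    (hR : ∀ a : R, ∃ e, e * a = a ∧ ∀ y, y * a = 0 → y * e = 0) (x : FractionRing R) :
    ∃ y, x * y * x = x := by
  obtain ⟨a, s, rfl⟩ := IsLocalization.exists_mk'_eq (nonZeroDivisors R) x
  obtain ⟨e, hea, he⟩ := hR a
  have he1 : (1 - e) * a = 0 := by rw [sub_mul, hea, one_mul, sub_self]
  have he2 : (1 - e) * e = 0 := he _ he1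
  have hu : a + (1 - e) ∈ nonZeroDivisors R := by
    rw [mem_nonZeroDivisors_iff_right]
    intro y hy
    have h1 : y * e = 0 := he y (by linear_combination e * hy - y * he2 - y * hea)
    linear_combination hy - a * h1 + h1 + y * hea
  refine ⟨IsLocalization.mk' _ (s : R) ⟨_, hu⟩, ?_⟩
  rw [← IsLocalization.mk'_mul, ← IsLocalization.mk'_mul, IsLocalization.mk'_eq_iff_eq]
  congr 1
  simp only [Submonoid.coe_mul]
  linear_combination (- (s : R) ^ 2) * he1

end RegularTotalFractionRing

section LaurentFactorial

theorem AddMonoidAlgebra.exists_single_mul_eq_mapDomain (k : Type*) [CommSemiring k] (n : ℕ)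
    (f : AddMonoidAlgebra k (Fin n →₀ ℤ)) :
    ∃ (a : Fin n →₀ ℕ) (p : AddMonoidAlgebra k (Fin n →₀ ℕ)),
      f * single (a.mapRange Int.ofNat rfl) 1 =
        mapDomain (Finsupp.mapRange Int.ofNat rfl) p := by
  have hadd (a b : Fin n →₀ ℕ) : (a + b).mapRange Int.ofNat rfl =
      a.mapRange Int.ofNat rfl + b.mapRange Int.ofNat rfl := by ext; simp
  have shift (a : Fin n →₀ ℕ) (p : AddMonoidAlgebra k (Fin n →₀ ℕ)) :
      mapDomain (Finsupp.mapRange Int.ofNat rfl) p * single (a.mapRange Int.ofNat rfl) 1 =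
        mapDomain (Finsupp.mapRange Int.ofNat rfl) (p * single a 1) := by
    induction p using AddMonoidAlgebra.induction_linear with
    | zero => simp
    | add p q hp hq => simp only [mapDomain_add, add_mul, hp, hq]
    | single b r => simp only [mapDomain_single, single_mul_single, hadd]
  induction f using AddMonoidAlgebra.induction_linear with
  | zero => exact ⟨0, 0, by simp⟩
  | add f g hf hg =>
    obtain ⟨a, p, hp⟩ := hf
    obtain ⟨b, q, hq⟩ := hg
    refine ⟨a + b, p * single b 1 + q * single a 1, ?_⟩
    rw [mapDomain_add, ← shift, ← shift, ← hp, ← hq, hadd, ← one_mul (1 : k),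
      ← single_mul_single]
    ring_nf
  | single g r =>
    refine ⟨g.mapRange (fun z => (-z).toNat) rfl, single (g.mapRange Int.toNat rfl) r, ?_⟩
    rw [mapDomain_single, single_mul_single, mul_one]
    congr 1
    ext i
    simp
    omega

theorem AddMonoidAlgebra.uniqueFactorizationMonoid_laurent (k : Type*) [Field k] (n : ℕ) :
    UniqueFactorizationMonoid (AddMonoidAlgebra k (Fin n →₀ ℤ)) := by
  let c : (Fin n →₀ ℕ) →+ (Fin n →₀ ℤ) := Finsupp.mapRange.addMonoidHom (Nat.castAddMonoidHom ℤ)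
  let ι : MvPolynomial (Fin n) k →+* AddMonoidAlgebra k (Fin n →₀ ℤ) :=
    AddMonoidAlgebra.mapDomainRingHom k c
  have hc : Function.Injective c := Finsupp.mapRange_injective _ rfl Nat.cast_injective
  have hι : Function.Injective ι := AddMonoidAlgebra.mapDomain_injective hc
  let S : Submonoid (MvPolynomial (Fin n) k) :=
    { carrier := Set.range fun a => MvPolynomial.monomial a 1
      one_mem' := ⟨0, rfl⟩
      mul_mem' := by
        rintro _ _ ⟨a, rfl⟩ ⟨b, rfl⟩
        exact ⟨a + b, by simp [MvPolynomial.monomial_mul]⟩ }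
  have hS (a : Fin n →₀ ℕ) : ι (MvPolynomial.monomial a 1) = single (c a) 1 :=
    AddMonoidAlgebra.mapDomain_single
  algebraize [ι]
  have : IsLocalization S (AddMonoidAlgebra k (Fin n →₀ ℤ)) :=
    { map_units := by
        rintro ⟨_, a, rfl⟩
        refine IsUnit.of_mul_eq_one (single (-(c a)) 1) ?_
        rw [RingHom.algebraMap_toAlgebra, hS, single_mul_single, add_neg_cancel, mul_one,
          one_def]
      surj := fun f => by
        obtain ⟨a, p, h⟩ := exists_single_mul_eq_mapDomain k n f
        refine ⟨(p, ⟨_, a, rfl⟩), ?_⟩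
        rw [RingHom.algebraMap_toAlgebra, hS]
        exact h
      exists_of_eq := fun {f g} h => ⟨1, by rw [hι h]⟩ }
  exact UniqueFactorizationMonoid.of_isLocalization S _

end LaurentFactorial

section PicLaurent

open TensorProduct

theorem Module.Invertible.exists_sub_smul_mem {A : Type u} [CommRing A] (I : Ideal A)
    [Subsingleton (CommRing.Pic (A ⧸ I))] (Q : Type u) [AddCommGroup Q] [Module A Q]
    [Module.Invertible A Q] :
    ∃ q : Q, ∀ x : Q, ∃ a : A, x - a • q ∈ I • (⊤ : Submodule A Q) := by
  obtain ⟨e⟩ := (free_iff_linearEquiv (R := A ⧸ I) (M := (A ⧸ I) ⊗[A] Q)).1 inferInstance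
  have hs := TensorProduct.mk_surjective A Q (A ⧸ I) Ideal.Quotient.mk_surjective
  obtain ⟨q, hq⟩ := hs (e.symm 1)
  refine ⟨q, fun x => ?_⟩
  obtain ⟨a, ha⟩ := Ideal.Quotient.mk_surjective (e (TensorProduct.mk A (A ⧸ I) Q 1 x))
  refine ⟨a, ?_⟩
  rw [← LinearMap.ker_tensorProductMk, LinearMap.mem_ker, map_sub, map_smul, sub_eq_zero, hq]
  apply e.injective
  rw [← ha, ← algebraMap_smul (A ⧸ I) a (e.symm 1), map_smul, e.apply_symm_apply, smul_eq_mul,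
    mul_one]
  rfl

theorem subsingleton_pic_laurent_of_regular {K : Type u} [CommRing K]
    (hK : ∀ x : K, ∃ y, x * y * x = x) (n : ℕ) :
    Subsingleton (CommRing.Pic (AddMonoidAlgebra K (Fin n →₀ ℤ))) := by
  rw [CommRing.Pic.subsingleton_iff]
  classical
  intro Q _ _ _
  let A := AddMonoidAlgebra K (Fin n →₀ ℤ)
  let C : K →+* A := AddMonoidAlgebra.singleZeroRingHom
  let T : Ideal K :=
    { carrier := {d | ∃ q : Q, ∀ x : Q, ∃ a : A, C d • x = a • q}
      zero_mem' := ⟨0, fun x => ⟨0, by simp⟩⟩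
      smul_mem' := by
        rintro c d ⟨q, hq⟩
        refine ⟨q, fun x => ?_⟩
        obtain ⟨a, ha⟩ := hq x
        exact ⟨C c * a, by rw [smul_eq_mul, map_mul, mul_smul, ha, mul_smul]⟩
      add_mem' := by
        rintro c d ⟨q, hq⟩ ⟨r, hr⟩
        obtain ⟨y, hy⟩ := hK c
        have hy' : C c * C y * C c = C c := by rw [← map_mul, ← map_mul, hy]
        let e := C c * C y
        refine ⟨e • q + (1 - e) • r, fun x => ?_⟩
        obtain ⟨a, ha⟩ := hq ((C c + C d) • x)
        obtain ⟨b, hb⟩ := hr x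
        refine ⟨e * C y * a + (1 - e) * b, ?_⟩
        rw [map_add]
        simp only [e]
        linear_combination (norm := module) (C c * C y * C y) • ha + (1 - C c * C y) • hb +
          (-(C c * C y + 1) - C y * C d) • hy' • x - (C y * (C y * a - b)) • hy' • q -
          (C y * (b - C y * a)) • hy' • r }
  have hT : T = ⊤ := by
    by_contra hne
    obtain ⟨m, hm, hle⟩ := Ideal.exists_le_maximal T hne
    let _ : Field (K ⧸ m) := Ideal.Quotient.field m
    let π : A →+* AddMonoidAlgebra (K ⧸ m) (Fin n →₀ ℤ) :=
      AddMonoidAlgebra.mapRingHom _ (Ideal.Quotient.mk m)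
    have hπ : Function.Surjective π :=
      AddMonoidAlgebra.map_surjective _ Ideal.Quotient.mk_surjective
    let e := RingHom.quotientKerEquivOfSurjective hπ
    have := AddMonoidAlgebra.uniqueFactorizationMonoid_laurent (K ⧸ m) n
    have : IsDomain (A ⧸ RingHom.ker π) := e.toMulEquiv.isDomain _
    have : UniqueFactorizationMonoid (A ⧸ RingHom.ker π) :=
      e.symm.toMulEquiv.uniqueFactorizationMonoid ‹_›
    obtain ⟨q, hq⟩ := Module.Invertible.exists_sub_smul_mem (RingHom.ker π) Q
    have hcoeff (c : K) (hc : c ∈ m) : ∃ d ∉ m, d * c = 0 := by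
      obtain ⟨y, hy⟩ := hK c
      refine ⟨1 - y * c, fun h => hm.ne_top ((Ideal.eq_top_iff_one _).2 ?_),
        by linear_combination -hy⟩
      simpa using m.add_mem h (m.mul_mem_left y hc)
    have hker (f : A) (hf : f ∈ RingHom.ker π) : ∃ d ∉ m, C d * f = 0 := by
      have hfm (g) : f.coeff g ∈ m := by
        rw [← Ideal.Quotient.eq_zero_iff_mem, ← AddMonoidAlgebra.coeff_mapRingHom]
        exact congrArg (fun p => p.coeff g) hf
      choose d hd hd0 using fun g => hcoeff _ (hfm g)
      refine ⟨∏ g ∈ f.coeff.support, d g, fun h => ?_, ?_⟩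
      · obtain ⟨g, -, hg⟩ := (hm.isPrime.prod_mem_iff).1 h
        exact hd g hg
      · ext g
        change (AddMonoidAlgebra.single 0 _ * f).coeff g = 0
        rw [AddMonoidAlgebra.coeff_single_zero_mul]
        by_cases hg : g ∈ f.coeff.support
        · rw [← Finset.prod_erase_mul _ _ hg, mul_assoc, hd0, mul_zero]
        · rw [Finsupp.notMem_support_iff.1 hg, mul_zero]
    have hkill (z : Q) (hz : z ∈ RingHom.ker π • (⊤ : Submodule A Q)) :
        ∃ d ∉ m, C d • z = 0 := by
      induction hz using Submodule.smul_induction_on' with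
      | smul f hf x _ =>
        obtain ⟨d, hd, h0⟩ := hker f hf
        exact ⟨d, hd, by rw [← mul_smul, h0, zero_smul]⟩
      | add x _ y _ hx hy =>
        obtain ⟨c, hc, hx⟩ := hx
        obtain ⟨d, hd, hy⟩ := hy
        refine ⟨c * d, fun h => (hm.isPrime.mem_or_mem h).elim hc hd, ?_⟩
        rw [smul_add, map_mul, mul_smul (C c) (C d) y, hy, mul_comm, mul_smul, hx]
        simp
    have hloc (x : Q) : ∃ d ∉ m, C d • x ∈ Submodule.span A {q} := by
      obtain ⟨a, ha⟩ := hq x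
      obtain ⟨d, hd, h0⟩ := hkill _ ha
      refine ⟨d, hd, Submodule.mem_span_singleton.2 ⟨C d * a, ?_⟩⟩
      rw [smul_sub, sub_eq_zero] at h0
      rw [h0, mul_smul]
    choose d hd hdq using hloc
    obtain ⟨s, hs⟩ := Module.Finite.fg_top (R := A) (M := Q)
    have hmem : ∏ x ∈ s, d x ∈ T := by
      have hle : ⊤ ≤ (Submodule.span A {q}).comap (LinearMap.lsmul A Q (C (∏ x ∈ s, d x))) := by
        rw [← hs, Submodule.span_le]
        intro x hx
        simp only [Submodule.comap_coe, Set.mem_preimage, LinearMap.lsmul_apply, SetLike.mem_coe]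
        rw [← Finset.prod_erase_mul _ _ hx, map_mul, mul_smul]
        exact Submodule.smul_mem _ _ (hdq x)
      refine ⟨q, fun x => ?_⟩
      obtain ⟨a, ha⟩ := Submodule.mem_span_singleton.1 (hle (x := x) trivial)
      exact ⟨a, ha.symm⟩
    obtain ⟨x, -, hx⟩ := (hm.isPrime.prod_mem_iff).1 (hle hmem)
    exact hd x hx
  obtain ⟨q, hq⟩ : (1 : K) ∈ T := hT ▸ trivial
  have hs : Function.Surjective (LinearMap.toSpanSingleton A Q q) := fun x => by
    obtain ⟨a, ha⟩ := hq x
    exact ⟨a, by simpa using ha.symm⟩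
  exact .of_equiv (LinearEquiv.ofBijective _ (Module.Invertible.bijective_of_surjective hs))

end PicLaurent

section Content

open AddMonoidAlgebra

variable {R : Type*} [CommRing R] {K : Type*} [CommRing K] [Algebra R K]

theorem IsLocalization.exists_smul_eq_mapRingHom (S : Submonoid R) [IsLocalization S K]
    {G : Type*} [AddMonoid G] (F : AddMonoidAlgebra K G) :
    ∃ (s : S) (f : AddMonoidAlgebra R G), mapRingHom G (algebraMap R K) f = (s : R) • F := by
  obtain ⟨s, hs⟩ := IsLocalization.exist_integer_multiples S F.coeff.support F.coeff
  have : (s : R) • F ∈ Set.range (AddMonoidAlgebra.map (M := G) (algebraMap R K : R →+ K)) := by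
    rw [range_map]
    intro g
    by_cases hg : g ∈ F.coeff.support
    · exact hs g hg
    · exact ⟨0, by simp [Finsupp.notMem_support_iff.1 hg]⟩
  exact ⟨s, this⟩

theorem coeff_mul_coeff_mem_range [IsFractionRing R K]
    (hR : ∀ I : Ideal R, I.FG → Module.Projective R I)
    {G : Type*} [AddCommMonoid G] [IsCancelAdd G] [UniqueSums G]
    (F H : AddMonoidAlgebra K G) (w : AddMonoidAlgebra R G)
    (hw : mapRingHom G (algebraMap R K) w = F * H) (a b : G) :
    F.coeff a * H.coeff b ∈ (algebraMap R K).range := by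
  obtain ⟨s, f, hf⟩ := IsLocalization.exists_smul_eq_mapRingHom (nonZeroDivisors R) F
  obtain ⟨t, h, hh⟩ := IsLocalization.exists_smul_eq_mapRingHom (nonZeroDivisors R) H
  have hinj : Function.Injective (mapRingHom G (algebraMap R K)) :=
    map_injective _ (IsFractionRing.injective R K)
  have hmul : f * h = single 0 (s * t : R) * w := by
    apply hinj
    rw [map_mul, map_mul, hf, hh, hw, mapRingHom_single, smul_mul_smul_comm]
    ext g
    rw [coeff_single_zero_mul, coeff_smul, Finsupp.smul_apply, Algebra.smul_def]
  obtain ⟨r, hr⟩ := dvd_coeff_mul_coeff_of_semihereditary hR (s * t : R) f h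
    (fun g => by rw [hmul, coeff_single_zero_mul]; exact dvd_mul_right _ _) a b
  refine ⟨r, (IsLocalization.map_units K (s * t)).mul_left_cancel ?_⟩
  have hfa : algebraMap R K (f.coeff a) = algebraMap R K s * F.coeff a := by
    rw [← coeff_mapRingHom, hf, coeff_smul, Finsupp.smul_apply, Algebra.smul_def]
  have hhb : algebraMap R K (h.coeff b) = algebraMap R K t * H.coeff b := by
    rw [← coeff_mapRingHom, hh, coeff_smul, Finsupp.smul_apply, Algebra.smul_def]
  rw [Submonoid.coe_mul, ← map_mul, ← hr, map_mul, hfa, hhb, map_mul]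
  ring

open scoped AlgebraMonoidAlgebra

/-- The `R`-submodule of `K` spanned by the coefficients of the elements of an `R[G]`-submodule
of `K[G]`. -/
noncomputable def contentSubmodule {G : Type*} [AddCommMonoid G]
    (I : Submodule (AddMonoidAlgebra R G) (AddMonoidAlgebra K G)) : Submodule R K :=
  Submodule.span R {c | ∃ F ∈ I, ∃ g, F.coeff g = c}

/-- The `R[G]`-submodule of `K[G]` generated by an `R`-submodule of `K`. -/
noncomputable def extendSubmodule (G : Type*) [AddCommMonoid G] (I : Submodule R K) :
    Submodule (AddMonoidAlgebra R G) (AddMonoidAlgebra K G) :=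
  Submodule.span _ (single 0 '' (I : Set K))

theorem contentSubmodule_mul_le_one [IsFractionRing R K]
    (hR : ∀ I : Ideal R, I.FG → Module.Projective R I)
    {G : Type*} [AddCommMonoid G] [IsCancelAdd G] [UniqueSums G]
    {I J : Submodule (AddMonoidAlgebra R G) (AddMonoidAlgebra K G)} (h : I * J ≤ 1) :
    contentSubmodule I * contentSubmodule J ≤ 1 := by
  rw [contentSubmodule, contentSubmodule, Submodule.span_mul_span, Submodule.span_le]
  rintro _ ⟨_, ⟨F, hF, a, rfl⟩, _, ⟨H, hH, b, rfl⟩, rfl⟩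
  obtain ⟨w, hw⟩ := Submodule.mem_one.1 (h (Submodule.mul_mem_mul hF hH))
  exact Submodule.mem_one.2 (coeff_mul_coeff_mem_range hR F H w hw a b)

theorem one_le_contentSubmodule_mul {G : Type*} [AddCommMonoid G]
    {I J : Submodule (AddMonoidAlgebra R G) (AddMonoidAlgebra K G)} (h : 1 ≤ I * J) :
    1 ≤ contentSubmodule I * contentSubmodule J := by
  classical
  have key (x : AddMonoidAlgebra K G) (hx : x ∈ I * J) (g : G) :
      x.coeff g ∈ contentSubmodule I * contentSubmodule J := by
    induction hx using Submodule.mul_induction_on' with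
    | mem_mul_mem F hF H hH =>
      rw [coeff_mul]
      refine Submodule.sum_mem _ fun a _ => Submodule.sum_mem _ fun b _ => ?_
      dsimp only
      split_ifs
      · exact Submodule.mul_mem_mul (Submodule.subset_span ⟨F, hF, a, rfl⟩)
          (Submodule.subset_span ⟨H, hH, b, rfl⟩)
      · exact Submodule.zero_mem _
    | add x _ y _ hx hy => exact Submodule.add_mem _ hx hy
  rw [Submodule.one_le]
  have := key 1 (Submodule.one_le.1 h) 0
  rwa [one_def, coeff_single, Finsupp.single_eq_same] at this

theorem le_extendSubmodule_contentSubmodule {G : Type*} [AddCommMonoid G]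
    (I : Submodule (AddMonoidAlgebra R G) (AddMonoidAlgebra K G)) :
    I ≤ extendSubmodule G (contentSubmodule I) := by
  intro F hF
  rw [← sum_coeff_single F]
  refine Submodule.sum_mem _ fun g _ => ?_
  have : single g (F.coeff g) = (single g 1 : AddMonoidAlgebra R G) • single 0 (F.coeff g) := by
    simp [Algebra.smul_def]
  rw [this]
  exact Submodule.smul_mem _ _
    (Submodule.subset_span ⟨_, Submodule.subset_span ⟨F, hF, g, rfl⟩, rfl⟩)

theorem extendSubmodule_mul_le_one (G : Type*) [AddCommMonoid G] {I J : Submodule R K}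
    (h : I * J ≤ 1) : extendSubmodule G I * extendSubmodule G J ≤ 1 := by
  rw [extendSubmodule, extendSubmodule, Submodule.span_mul_span, Submodule.span_le]
  rintro _ ⟨_, ⟨a, ha, rfl⟩, _, ⟨b, hb, rfl⟩, rfl⟩
  obtain ⟨r, hr⟩ := Submodule.mem_one.1 (h (Submodule.mul_mem_mul ha hb))
  refine Submodule.mem_one.2 ⟨single 0 r, ?_⟩
  simp [hr]

theorem extendSubmodule_contentSubmodule [IsFractionRing R K]
    (hR : ∀ I : Ideal R, I.FG → Module.Projective R I)
    {G : Type*} [AddCommMonoid G] [IsCancelAdd G] [UniqueSums G]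
    {I J : Submodule (AddMonoidAlgebra R G) (AddMonoidAlgebra K G)} (h : I * J = 1) :
    extendSubmodule G (contentSubmodule I) = I := by
  refine le_antisymm ?_ (le_extendSubmodule_contentSubmodule I)
  calc extendSubmodule G (contentSubmodule I)
      = extendSubmodule G (contentSubmodule I) * J * I := by
        rw [mul_assoc, mul_comm J I, h, mul_one]
    _ ≤ extendSubmodule G (contentSubmodule I) * extendSubmodule G (contentSubmodule J) * I :=
      mul_le_mul'
        (mul_le_mul' le_rfl (le_extendSubmodule_contentSubmodule J)) le_rfl
    _ ≤ 1 * I := mul_le_mul'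
      (extendSubmodule_mul_le_one G (contentSubmodule_mul_le_one hR h.le)) le_rfl
    _ = I := one_mul I

end Content

section Surjective

open TensorProduct

open scoped AlgebraMonoidAlgebra

theorem exists_mk_eq_of_isUnit {R : Type u} [CommRing R] {K : Type u} [CommRing K] [Algebra R K]
    [IsFractionRing R K] (hR : IsSemihereditary R) {G : Type} [AddCommGroup G] [UniqueSums G]
    (I : (Submodule (AddMonoidAlgebra R G) (AddMonoidAlgebra K G))ˣ) :
    ∃ P : CommRing.Pic R, Nonempty (AddMonoidAlgebra R G ⊗[R] P ≃ₗ[AddMonoidAlgebra R G] I) := by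
  have : FaithfulSMul R K := (faithfulSMul_iff_algebraMap_injective R K).2
    (IsFractionRing.injective R K)
  have : FaithfulSMul (AddMonoidAlgebra R G) (AddMonoidAlgebra K G) :=
    (faithfulSMul_iff_algebraMap_injective _ _).2
      (AddMonoidAlgebra.map_injective _ (IsFractionRing.injective R K))
  have h1 {I J : Submodule (AddMonoidAlgebra R G) (AddMonoidAlgebra K G)} (h : I * J = 1) :
      contentSubmodule I * contentSubmodule J = 1 :=
    le_antisymm (contentSubmodule_mul_le_one hR h.le) (one_le_contentSubmodule_mul h.ge)
  let J : (Submodule R K)ˣ := ⟨contentSubmodule I.1, contentSubmodule I⁻¹.1, h1 I.mul_inv,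
    h1 I.inv_mul⟩
  have : Module.Invertible R J.1 := .left (Submodule.tensorInvEquiv J)
  let s : K →ₗ[R] AddMonoidAlgebra K G := AddMonoidAlgebra.lsingle 0
  let l : J.1 →ₗ[R] AddMonoidAlgebra K G := s ∘ₗ J.1.subtype
  have hl : LinearMap.range (l.liftBaseChange (AddMonoidAlgebra R G)) = I := by
    rw [LinearMap.range_liftBaseChange, ← extendSubmodule_contentSubmodule hR I.mul_inv,
      extendSubmodule, LinearMap.coe_range, LinearMap.coe_comp, Set.range_comp]
    simp [s, J]
    rfl
  let f := (LinearEquiv.ofEq _ _ hl).toLinearMap ∘ₗ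
    (l.liftBaseChange (AddMonoidAlgebra R G)).rangeRestrict
  have hf : Function.Bijective f := Module.Invertible.bijective_of_surjective
    ((LinearEquiv.ofEq _ _ hl).surjective.comp (LinearMap.surjective_rangeRestrict _))
  exact ⟨CommRing.Pic.mk R J, ⟨AlgebraTensorModule.congr (.refl _ _)
    (CommRing.Pic.mk.linearEquiv R J) ≪≫ₗ LinearEquiv.ofBijective f hf⟩⟩

theorem mapAlgebra_laurent_surjective {R : Type u} [CommRing R] (hR : IsSemihereditary R) (n : ℕ) :
    Function.Surjective (CommRing.Pic.mapAlgebra R (AddMonoidAlgebra R (Fin n →₀ ℤ))) := by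
  intro P
  have : FaithfulSMul (AddMonoidAlgebra R (Fin n →₀ ℤ))
      (AddMonoidAlgebra (FractionRing R) (Fin n →₀ ℤ)) :=
    (faithfulSMul_iff_algebraMap_injective _ _).2
      (AddMonoidAlgebra.map_injective _ (IsFractionRing.injective R (FractionRing R)))
  have := subsingleton_pic_laurent_of_regular
    (exists_mul_mul_eq_self_fractionRing (exists_mul_eq_self_of_semihereditary hR)) n
  obtain ⟨I, rfl⟩ : P ∈ (Submodule.unitsToPic (AddMonoidAlgebra R (Fin n →₀ ℤ))
      (AddMonoidAlgebra (FractionRing R) (Fin n →₀ ℤ))).range := by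
    rw [Submodule.range_unitsToPic, CommRing.relPic_eq_top]
    trivial
  obtain ⟨Q, ⟨e⟩⟩ := exists_mk_eq_of_isUnit hR I
  exact ⟨Q, CommRing.Pic.mk_eq_mk_iff.2 ⟨e⟩⟩

end Surjective

theorem mapAlgebra_addMonoidAlgebra_injective (R : Type u) [CommRing R] (G : Type)
    [AddCommMonoid G] :
    Function.Injective (CommRing.Pic.mapAlgebra R (AddMonoidAlgebra R G)) := by
  let ε : AddMonoidAlgebra R G →ₐ[R] R := AddMonoidAlgebra.lift R R G 1
  rw [← CommRing.Pic.mapRingHom_algebraMap]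
  refine Function.LeftInverse.injective (g := CommRing.Pic.mapRingHom (ε : _ →+* R)) fun P => ?_
  rw [CommRing.Pic.mapRingHom_mapRingHom, ε.comp_algebraMap]
  exact CommRing.Pic.mapRingHom_id_apply

/-- If `R` is a semihereditary commutative ring, the natural inclusion of `R` into
the Laurent polynomial ring `R[t₁,t₁⁻¹,…,tₙ,tₙ⁻¹]` (base change of modules) induces an
isomorphism on Picard groups. -/
theorem pic_laurent_of_semihereditary (R : Type u) [CommRing R]
    (hR : IsSemihereditary R) (n : ℕ) :
    ∃ φ : PicG R →+ PicG (AddMonoidAlgebra R (Fin n →₀ ℤ)),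
      Function.Bijective φ ∧
      ∀ (M : InvCl R)
        (h : IsInvMod (AddMonoidAlgebra R (Fin n →₀ ℤ))
          (ModuleCat.of (AddMonoidAlgebra R (Fin n →₀ ℤ))
            (TensorProduct R (AddMonoidAlgebra R (Fin n →₀ ℤ)) (M.1 : Type u)))),
        φ (PicG.cls R M) = PicG.cls (AddMonoidAlgebra R (Fin n →₀ ℤ))
          ⟨ModuleCat.of (AddMonoidAlgebra R (Fin n →₀ ℤ))
            (TensorProduct R (AddMonoidAlgebra R (Fin n →₀ ℤ)) (M.1 : Type u)), h⟩ := by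
  let ψ := AddEquiv.ofBijective _
    (PicG.toPic_bijective (AddMonoidAlgebra R (Fin n →₀ ℤ)))
  let μ := MonoidHom.toAdditive (CommRing.Pic.mapAlgebra R (AddMonoidAlgebra R (Fin n →₀ ℤ)))
  have hμ : Function.Bijective μ :=
    ⟨mapAlgebra_addMonoidAlgebra_injective R _, mapAlgebra_laurent_surjective hR n⟩
  refine ⟨ψ.symm.toAddMonoidHom.comp (μ.comp (PicG.toPic R)),
    ψ.symm.bijective.comp (hμ.comp (PicG.toPic_bijective R)), fun M h => ?_⟩
  change ψ.symm (μ (PicG.toPic R (PicG.cls R M))) = _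
  rw [AddEquiv.symm_apply_eq, PicG.toPic_cls]
  refine Eq.trans ?_ (PicG.toPic_cls _ _).symm
  exact congrArg Additive.ofMul (CommRing.Pic.mk_eq_mk_iff.2
    ⟨TensorProduct.AlgebraTensorModule.congr (.refl _ _) (CommRing.Pic.mk.linearEquiv R M.1)⟩)
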